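/- arXiv:0907.1976 — 6 statements merged into one kernel-verified Lean document; each statement's English description precedes it below -/
import Mathlib

section
/- Let Ω ⊂ ℝ² be a nonempty bounded open set with Ω ∩ B₁(0) = ∅, Σ := closure(∂Ω \ ∂B₁(0)), Σ' := ∂Ω \ Σ, and d := diam Ω. Suppose u ∈ C²(Ω) ∩ C¹(Ω̄) satisfies ⟨∇u(z), z⟩ ≥ 0 for all z ∈ Σ', u ≤ 0 on Σ, and u attains its maximum over Ω̄ at a point z₀ with u(z₀) > 0. Then for every p ∈ ℝ² with |p| < u(z₀)/d and ⟨p, z₀⟩ < 0 there exists z* ∈ Ω such that u(z) ≤ u(z*) + ⟨p, z − z*⟩ for all z ∈ Ω̄; that is, the half-ball {p ∈ ℝ² : |p| < u(z₀)/d, p·z₀ < 0} is contained in χ_u(Γ_u). -/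
open MeasureTheory Metric Set RealInnerProductSpace

theorem aux_sub {E : Type*} [NormedAddCommGroup E] {Ω C : Set E} (hC : IsPreconnected C)
    (h1 : (C ∩ Ω).Nonempty) (hfr : ∀ x ∈ C, x ∉ frontier Ω) : C ⊆ Ω := by
  intro x hx
  by_contra hxΩ
  have hcl : ∀ y ∈ C, y ∈ closure Ω → y ∈ interior Ω := fun y hy h => by
    by_contra h2
    exact hfr y hy ⟨h, h2⟩
  obtain ⟨w, hw, hwΩ⟩ := h1
  obtain ⟨y, -, hy1, hy2⟩ := hC (interior Ω) (closure Ω)ᶜ isOpen_interior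
    isClosed_closure.isOpen_compl
    (fun y hy => by
      by_cases h : y ∈ closure Ω
      · exact Or.inl (hcl y hy h)
      · exact Or.inr h)
    ⟨w, hw, hcl w hw (subset_closure hwΩ)⟩
    ⟨x, hx, fun h => hxΩ (interior_subset (hcl x hx h))⟩
  exact hy2 (subset_closure (interior_subset hy1))

theorem aux_radial {E : Type*} [NormedAddCommGroup E] [InnerProductSpace ℝ E]
    {Ω : Set E} (z : E) (hz : ‖z‖ = 1) (hzc : z ∈ closure Ω) (r : ℝ) (hr : 0 < r) (hr1 : r ≤ 1)
    (hout : ∀ x ∈ Ω, 1 < ‖x‖)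
    (hfr : ∀ x ∈ Metric.ball z r, 1 < ‖x‖ → x ∉ frontier Ω) :
    ∀ t ∈ Ioo (0 : ℝ) r, z + t • z ∈ Ω := by
  obtain ⟨w, hw, hwz⟩ := Metric.mem_closure_iff.1 hzc (r / 8) (by positivity)
  have hw1 := hout w hw
  rw [dist_comm, dist_eq_norm] at hwz
  have hwn : ‖w‖ < 1 + r / 8 := by
    have : ‖w‖ ≤ ‖w - z‖ + ‖z‖ := by simpa using norm_add_le (w - z) z
    linarith
  have hball : ∀ a : ℝ, 0 ≤ a → a ≤ r / 4 → w + a • w ∈ Metric.ball z r := by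
    intro a ha ha'
    rw [Metric.mem_ball, dist_eq_norm]
    have h1 : ‖w + a • w - z‖ ≤ ‖w - z‖ + a * ‖w‖ := by
      have := norm_add_le (w - z) (a • w)
      rw [norm_smul, Real.norm_of_nonneg ha] at this
      rwa [show w + a • w - z = (w - z) + a • w by abel]
    nlinarith [norm_nonneg w]
  have hseg : (fun a : ℝ => w + a • w) '' Icc 0 (r / 4) ⊆ Ω := by
    apply aux_sub
    · exact isPreconnected_Icc.image _ (by fun_prop)
    · exact ⟨w, ⟨0, ⟨le_rfl, by positivity⟩, by simp⟩, hw⟩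
    · rintro _ ⟨a, ⟨ha, ha'⟩, rfl⟩
      apply hfr _ (hball a ha ha')
      have : w + a • w = (1 + a) • w := by rw [add_smul, one_smul]
      simp only [this]
      rw [norm_smul, Real.norm_of_nonneg (by linarith)]
      nlinarith
  have hH : Metric.ball z r ∩ {x | 1 < ⟪z, x⟫} ⊆ Ω := by
    apply aux_sub
    · apply Convex.isPreconnected
      exact (convex_ball z r).inter (convex_halfSpace_gt (innerSL ℝ z).isLinear 1)
    · refine ⟨w + (r / 4) • w, ⟨hball _ (by positivity) le_rfl, ?_⟩,
        hseg ⟨r / 4, ⟨by positivity, le_rfl⟩, rfl⟩⟩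
      simp only [mem_setOf_eq, inner_add_right, inner_smul_right]
      have h2 : ⟪z, w⟫ = 1 + ⟪z, w - z⟫ := by
        rw [inner_sub_right, real_inner_self_eq_norm_sq, hz]; ring
      have h3 := abs_real_inner_le_norm z (w - z)
      rw [hz, one_mul] at h3
      have h4 := neg_abs_le ⟪z, w - z⟫
      have h5 : 1 - r / 8 < ⟪z, w⟫ := by linarith
      nlinarith
    · rintro x ⟨hx, hx2⟩
      apply hfr x hx
      have := real_inner_le_norm z x
      rw [hz, one_mul] at this
      exact lt_of_lt_of_le hx2 this
  rintro t ⟨ht, ht'⟩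
  apply hH
  constructor
  · rw [Metric.mem_ball, dist_eq_norm, add_sub_cancel_left, norm_smul, hz, mul_one,
      Real.norm_of_nonneg ht.le]
    exact ht'
  · simp only [mem_setOf_eq, inner_add_right, inner_smul_right, real_inner_self_eq_norm_sq, hz]
    linarith

/-- "Claim 1": if u ≤ 0 on Σ, the radial derivative of u is ≥ 0
on Σ', and u attains a positive maximum, then the half-ball
{p : |p| < u(z₀)/d, p·z₀ < 0} consists of upper differentials of u, i.e. it is
contained in χ_u(Γ_u). -/
theorem stmt_2
    (Ω : Set (EuclideanSpace ℝ (Fin 2)))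
    (hΩopen : IsOpen Ω) (hΩne : Ω.Nonempty) (hΩbdd : Bornology.IsBounded Ω)
    (hΩdisj : Ω ∩ Metric.ball (0 : EuclideanSpace ℝ (Fin 2)) 1 = ∅)
    (Sg Sg' : Set (EuclideanSpace ℝ (Fin 2)))
    (hSg : Sg = closure (frontier Ω \ Metric.sphere (0 : EuclideanSpace ℝ (Fin 2)) 1))
    (hSg' : Sg' = frontier Ω \ Sg)
    (u : EuclideanSpace ℝ (Fin 2) → ℝ)
    -- u ∈ C²(Ω) ∩ C¹(Ω̄): u is C² in Ω and its gradient extends continuously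
    -- (as Du) to the closure of Ω
    (hu : ContDiffOn ℝ 2 u Ω) (huc : ContinuousOn u (closure Ω))
    (Du : EuclideanSpace ℝ (Fin 2) → EuclideanSpace ℝ (Fin 2))
    (hDuc : ContinuousOn Du (closure Ω))
    (hDu : ∀ z ∈ Ω, Du z = gradient u z)
    -- the Neumann condition ∂u/∂r ≥ 0 on Σ'
    (hneu : ∀ z ∈ Sg', 0 ≤ ⟪Du z, z⟫)
    -- u ≤ 0 on Σ
    (huSg : ∀ z ∈ Sg, u z ≤ 0)
    -- u attains its maximum over the closure of Ω at z₀, and u(z₀) > 0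
    (z₀ : EuclideanSpace ℝ (Fin 2)) (hz₀ : z₀ ∈ closure Ω)
    (hmax : ∀ z ∈ closure Ω, u z ≤ u z₀) (hpos : 0 < u z₀) :
    ∀ p : EuclideanSpace ℝ (Fin 2),
      ‖p‖ < u z₀ / Metric.diam Ω → ⟪p, z₀⟫ < 0 →
      ∃ zstar ∈ Ω, ∀ z ∈ closure Ω, u z ≤ u zstar + ⟪p, z - zstar⟫ := by
  intro p hp hpz
  have hd : 0 < Metric.diam Ω := by
    by_contra h
    have : Metric.diam Ω = 0 := le_antisymm (not_lt.1 h) Metric.diam_nonneg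
    rw [this, div_zero] at hp
    exact absurd hp (not_lt.2 (norm_nonneg _))
  rw [lt_div_iff₀ hd] at hp
  have hK : IsCompact (closure Ω) := hΩbdd.isCompact_closure
  obtain ⟨y, hy, hymax⟩ := hK.exists_isMaxOn ⟨z₀, hz₀⟩
    (f := fun z => u z - ⟪p, z⟫) (by fun_prop)
  have hymax' : ∀ z ∈ closure Ω, u z - ⟪p, z⟫ ≤ u y - ⟪p, y⟫ := fun z hz => hymax hz
  refine ⟨y, ?_, fun z hz => ?_⟩
  swap
  · have := hymax' z hz
    rw [inner_sub_right]; linarith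
  by_contra hyΩ
  have hyfr : y ∈ frontier Ω := by
    rw [hΩopen.frontier_eq]; exact ⟨hy, hyΩ⟩
  have hyz := hymax' z₀ hz₀
  have hySg : y ∉ Sg := by
    intro hyS
    have h1 := huSg y hyS
    have h2 : ⟪p, z₀ - y⟫ ≤ ‖p‖ * ‖z₀ - y‖ := real_inner_le_norm _ _
    have h3 : ‖z₀ - y‖ ≤ Metric.diam Ω := by
      rw [← Metric.diam_closure, ← dist_eq_norm]
      exact Metric.dist_le_diam_of_mem hΩbdd.closure hz₀ hy
    have h4 := mul_le_mul_of_nonneg_left h3 (norm_nonneg p)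
    rw [inner_sub_right] at h2
    linarith
  have hneuy := hneu y (by rw [hSg']; exact ⟨hyfr, hySg⟩)
  have hpy : ⟪p, y⟫ < 0 := by
    have := hmax y hy
    linarith
  have hy1 : ‖y‖ = 1 := by
    by_contra h
    apply hySg
    rw [hSg]
    exact subset_closure ⟨hyfr, by simpa using h⟩
  have hout1 : ∀ x ∈ Ω, 1 ≤ ‖x‖ := by
    intro x hx
    by_contra h
    have : x ∈ Ω ∩ Metric.ball (0 : EuclideanSpace ℝ (Fin 2)) 1 := ⟨hx, by simpa using h⟩
    rw [hΩdisj] at this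
    exact this
  have hout : ∀ x ∈ Ω, 1 < ‖x‖ := by
    intro x hx
    have hsub : Ω ⊆ (Metric.ball (0 : EuclideanSpace ℝ (Fin 2)) 1)ᶜ := by
      intro x hx; simpa using hout1 x hx
    have h := interior_maximal hsub hΩopen hx
    rw [interior_compl, closure_ball _ one_ne_zero] at h
    simpa using h
  have hSgc : IsClosed Sg := by rw [hSg]; exact isClosed_closure
  obtain ⟨r, hr, hrS⟩ := Metric.isOpen_iff.1 hSgc.isOpen_compl y hySg
  have hrad := aux_radial y hy1 hy (min r 1) (by positivity) (min_le_right _ _) hout (by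
    intro x hx hx1 hxf
    apply hrS (Metric.ball_subset_ball (min_le_left _ _) hx)
    rw [hSg]
    exact subset_closure ⟨hxf, by simpa using hx1.ne'⟩)
  have hcont : ContinuousOn (fun x => ⟪Du x - p, y⟫) (closure Ω) := by fun_prop
  have hposy : (0 : ℝ) < ⟪Du y - p, y⟫ := by rw [inner_sub_left]; linarith
  have hev := (hcont y hy).eventually (lt_mem_nhds hposy)
  obtain ⟨δ, hδ, hδ2⟩ := Metric.mem_nhdsWithin_iff.1 hev
  obtain ⟨ε, hε, hεr, hεδ⟩ : ∃ ε : ℝ, 0 < ε ∧ ε < min r 1 ∧ ε < δ := by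
    have : 0 < min (min r 1) δ := by positivity
    obtain ⟨e, he, he2⟩ := exists_between this
    exact ⟨e, he, lt_of_lt_of_le he2 (min_le_left _ _), lt_of_lt_of_le he2 (min_le_right _ _)⟩
  have hmem : ∀ t ∈ Icc (0 : ℝ) ε, y + t • y ∈ closure Ω := by
    rintro t ⟨ht, ht'⟩
    rcases ht.eq_or_lt with rfl | ht
    · simpa using hy
    · exact subset_closure (hrad t ⟨ht, lt_of_le_of_lt ht' hεr⟩)
  obtain ⟨c, hc, hc2⟩ := exists_hasDerivAt_eq_slope
    (fun t : ℝ => u (y + t • y) - ⟪p, y + t • y⟫)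
    (fun t : ℝ => ⟪Du (y + t • y) - p, y⟫) hε (by
      apply ContinuousOn.sub
      · exact huc.comp (by fun_prop) hmem
      · fun_prop) (by
      intro t ht
      have hΩt := hrad t ⟨ht.1, ht.2.trans hεr⟩
      have hdiff : DifferentiableAt ℝ u (y + t • y) :=
        (hu.contDiffAt (hΩopen.mem_nhds hΩt)).differentiableAt (by norm_num)
      have hg := hdiff.hasGradientAt.hasFDerivAt
      rw [← hDu _ hΩt] at hg
      have hl : HasDerivAt (fun t : ℝ => y + t • y) y t := by
        simpa using ((hasDerivAt_id t).smul_const y).const_add y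
      have h1 := hg.comp_hasDerivAt t hl
      have h2 := ((innerSL ℝ p).hasFDerivAt (x := y + t • y)).comp_hasDerivAt t hl
      have h3 := h1.sub h2
      rw [inner_sub_left]
      have h4 : HasDerivAt (fun t : ℝ => u (y + t • y) - ⟪p, y + t • y⟫)
          (⟪Du (y + t • y), y⟫ - ⟪p, y⟫) t := h3
      exact h4)
  have hcpos : (0 : ℝ) < ⟪Du (y + c • y) - p, y⟫ := by
    apply hδ2
    refine ⟨?_, hmem c ⟨hc.1.le, hc.2.le⟩⟩
    rw [Metric.mem_ball, dist_eq_norm, add_sub_cancel_left, norm_smul, hy1, mul_one,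
      Real.norm_of_nonneg hc.1.le]
    exact hc.2.trans hεδ

  rw [hc2] at hcpos
  have h5 := hymax' _ (hmem ε ⟨hε.le, le_rfl⟩)
  rw [lt_div_iff₀ (by linarith)] at hcpos
  simp only [zero_smul, add_zero, zero_mul] at hcpos
  linarith
end

section
/- Let Ω ⊂ ℝ² be a nonempty bounded open set with Ω ∩ B₁(0) = ∅, Σ := closure(∂Ω \ ∂B₁(0)), Σ' := ∂Ω \ Σ, and d := diam Ω. Let g : [0,∞) → [0,∞) be continuous, and let u ∈ C²(Ω) ∩ C¹(Ω̄) satisfy ⟨∇u(z), z⟩ ≥ 0 for all z ∈ Σ'. Set M := (sup_Ω u − sup_Σ u)/d. Then ∫₀^M g(ρ)·ρ dρ ≤ (1/(4π)) ∫_{Γ_u} g(|∇u(z)|)·(Δu(z))² dz, where Γ_u is the upper contact set of u and the integral on the right is with respect to Lebesgue measure on ℝ² (if M ≤ 0 the left-hand side is interpreted as the signed interval integral, which is then ≤ 0 ≤ the right-hand side). -/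
open MeasureTheory Metric Set RealInnerProductSpace

/-- The Laplacian of a real function on ℝ² (= `EuclideanSpace ℝ (Fin 2)`):
the sum of the two pure second partial derivatives. -/
noncomputable def lap (u : EuclideanSpace ℝ (Fin 2) → ℝ) (z : EuclideanSpace ℝ (Fin 2)) : ℝ :=
  ∑ i : Fin 2,
    iteratedFDeriv ℝ 2 u z ![EuclideanSpace.single i (1:ℝ), EuclideanSpace.single i (1:ℝ)]


lemma polar_aux (g : ℝ → ℝ) (hg : ContinuousOn g (Ici 0)) (hgnn : ∀ ρ ∈ Ici (0:ℝ), 0 ≤ g ρ)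
    (M : ℝ) (hM : 0 < M) :
    ∫⁻ p in ball (0 : EuclideanSpace ℝ (Fin 2)) M, ENNReal.ofReal (g ‖p‖)
      = ENNReal.ofReal (2 * Real.pi * ∫ ρ in (0:ℝ)..M, g ρ * ρ) := by
  have hcont : Continuous (fun p : EuclideanSpace ℝ (Fin 2) => g ‖p‖) :=
    hg.comp_continuous continuous_norm (fun x => norm_nonneg x)
  have hint : IntegrableOn (fun p : EuclideanSpace ℝ (Fin 2) => g ‖p‖) (ball 0 M) :=
    (hcont.continuousOn.integrableOn_compact (isCompact_closedBall 0 M)).mono_set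
      ball_subset_closedBall
  rw [← ofReal_integral_eq_lintegral_ofReal hint
    (Filter.Eventually.of_forall fun p => hgnn _ (norm_nonneg p))]
  congr 1
  have h1 := integral_fun_norm_addHaar (volume : Measure (EuclideanSpace ℝ (Fin 2)))
    ((Iio M).indicator g)
  have h2 : (fun x : EuclideanSpace ℝ (Fin 2) => (Iio M).indicator g ‖x‖)
      = (ball (0 : EuclideanSpace ℝ (Fin 2)) M).indicator (fun p => g ‖p‖) := by
    ext x
    simp [indicator]
  rw [h2, integral_indicator measurableSet_ball] at h1
  rw [h1]
  have h3 : (fun y : ℝ => y ^ (Module.finrank ℝ (EuclideanSpace ℝ (Fin 2)) - 1) •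
      (Iio M).indicator g y) = (Iio M).indicator (fun y => g y * y) := by
    ext y
    by_cases hy : y < M <;> simp [indicator, hy, mul_comm]
  rw [h3, setIntegral_indicator measurableSet_Iio, intervalIntegral.integral_of_le hM.le,
    integral_Ioc_eq_integral_Ioo]
  have h4 : Ioi (0:ℝ) ∩ Iio M = Ioo 0 M := rfl
  rw [h4]
  simp [Measure.real, InnerProductSpace.volume_ball_of_dim_even (E := EuclideanSpace ℝ (Fin 2)) (k := 1), ENNReal.toReal_ofReal Real.pi_pos.le]
  ring

lemma area_aux {E : Type*} [NormedAddCommGroup E] [NormedSpace ℝ E] [FiniteDimensional ℝ E]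
    [MeasurableSpace E] [BorelSpace E] (μ : Measure E) [μ.IsAddHaarMeasure]
    (s : Set E) (hs : MeasurableSet s) (f : E → E) (hfm : Measurable f) (f' : E → E →L[ℝ] E)
    (hf' : ∀ x ∈ s, HasFDerivWithinAt f (f' x) s x) (G : E → ENNReal) (hG : Measurable G) :
    ∫⁻ p in f '' s, G p ∂μ ≤ ∫⁻ x in s, ENNReal.ofReal |(f' x).det| * G (f x) ∂μ := by
  have hh := aemeasurable_ofReal_abs_det_fderivWithin μ hs hf'
  set h : E → ENNReal := fun x => ENNReal.ofReal |(f' x).det| with hdef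
  have hle : μ.restrict (f '' s) ≤ ((μ.restrict s).withDensity h).map f := by
    refine Measure.le_iff.2 fun B hB => ?_
    rw [Measure.restrict_apply hB, Measure.map_apply hfm hB,
      withDensity_apply _ (hfm hB), Measure.restrict_restrict (hfm hB)]
    have : B ∩ f '' s = f '' (f ⁻¹' B ∩ s) := by
      rw [inter_comm (f ⁻¹' B), image_inter_preimage, inter_comm]
    rw [this]
    exact addHaar_image_le_lintegral_abs_det_fderiv μ ((hfm hB).inter hs)
      fun x hx => (hf' x hx.2).mono inter_subset_right
  calc _ ≤ ∫⁻ p, G p ∂(((μ.restrict s).withDensity h).map f) := lintegral_mono' hle le_rfl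
    _ = ∫⁻ x, G (f x) ∂((μ.restrict s).withDensity h) := lintegral_map hG hfm
    _ = _ := by
      exact lintegral_withDensity_eq_lintegral_mul₀ hh (hG.comp hfm).aemeasurable

lemma area_aux' {E : Type*} [NormedAddCommGroup E] [NormedSpace ℝ E] [FiniteDimensional ℝ E]
    [MeasurableSpace E] [BorelSpace E] (μ : Measure E) [μ.IsAddHaarMeasure]
    (s : Set E) (hs : MeasurableSet s) (f : E → E) (f' : E → E →L[ℝ] E)
    (hf' : ∀ x ∈ s, HasFDerivWithinAt f (f' x) s x) (G : E → ENNReal) (hG : Measurable G) :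
    ∫⁻ p in f '' s, G p ∂μ ≤ ∫⁻ x in s, ENNReal.ofReal |(f' x).det| * G (f x) ∂μ := by
  classical
  have heq : EqOn (s.piecewise f 0) f s := piecewise_eqOn s f 0
  have hm : Measurable (s.piecewise f 0) :=
    ContinuousOn.measurable_piecewise (fun x hx => (hf' x hx).continuousWithinAt)
      continuousOn_const hs
  have := area_aux μ s hs (s.piecewise f 0) hm f'
    (fun x hx => (hf' x hx).congr heq (heq hx)) G hG
  rw [heq.image_eq] at this
  refine this.trans_eq (setLIntegral_congr_fun hs fun x hx => ?_)
  simp only [heq hx]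

lemma second_aux (φ φ' : ℝ → ℝ) (c : ℝ) (h1 : ∀ᶠ t in nhds 0, HasDerivAt φ (φ' t) t)
    (h2 : HasDerivAt φ' c 0) (hmax : IsLocalMax φ 0) : c ≤ 0 := by
  by_contra hc
  push Not at hc
  have hd : deriv φ =ᶠ[nhds 0] φ' := h1.mono fun t ht => ht.deriv
  have hdd : deriv (deriv φ) 0 = c := by rw [hd.deriv_eq, h2.deriv]
  have hmin : IsLocalMin φ 0 := isLocalMin_of_deriv_deriv_pos (by rw [hdd]; exact hc)
    hmax.deriv_eq_zero h1.self_of_nhds.continuousAt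
  have hconst : φ =ᶠ[nhds 0] fun _ => φ 0 := by
    filter_upwards [hmax, hmin] with t ht ht' using le_antisymm ht ht'
  have : deriv (deriv φ) 0 = 0 := by
    rw [hconst.deriv.deriv_eq]
    simp
  linarith

lemma contact_aux (u : EuclideanSpace ℝ (Fin 2) → ℝ) (z₀ p : EuclideanSpace ℝ (Fin 2))
    (hu : ContDiffAt ℝ 2 u z₀)
    (hc : ∀ᶠ z in nhds z₀, u z ≤ u z₀ + ⟪p, z - z₀⟫) :
    gradient u z₀ = p ∧ DifferentiableAt ℝ (gradient u) z₀ ∧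
      |(fderiv ℝ (gradient u) z₀).det| ≤ (lap u z₀) ^ 2 / 4 := by
  have hd1 : ∀ᶠ z in nhds z₀, DifferentiableAt ℝ u z :=
    (hu.eventually (by simp)).mono fun z hz => hz.differentiableAt (by simp)
  have hdd : DifferentiableAt ℝ (fderiv ℝ u) z₀ :=
    (hu.fderiv_right (m := 1) (by norm_num)).differentiableAt (by simp)
  let L : (EuclideanSpace ℝ (Fin 2) →L[ℝ] ℝ) →L[ℝ] EuclideanSpace ℝ (Fin 2) :=
    { toFun := (InnerProductSpace.toDual ℝ (EuclideanSpace ℝ (Fin 2))).symm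
      map_add' := fun x y => map_add _ x y
      map_smul' := fun c x => by simp
      cont := (InnerProductSpace.toDual ℝ (EuclideanSpace ℝ (Fin 2))).symm.continuous }
  have hgr : HasFDerivAt (gradient u)
      (L.comp (fderiv ℝ (fderiv ℝ u) z₀)) z₀ := 
    L.hasFDerivAt.comp z₀ hdd.hasFDerivAt
  set H := fderiv ℝ (fderiv ℝ u) z₀ with hH
  have hneg : ∀ v, H v v ≤ 0 := by
    intro v
    have hline : ∀ t : ℝ, HasDerivAt (fun t : ℝ => z₀ + t • v) v t := fun t => by
      simpa using ((hasDerivAt_id t).smul_const v).const_add z₀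
    have hlt : Filter.Tendsto (fun t : ℝ => z₀ + t • v) (nhds 0) (nhds z₀) := by
      simpa using (hline 0).continuousAt.tendsto
    refine second_aux (fun t => u (z₀ + t • v) - t * ⟪p, v⟫)
      (fun t => fderiv ℝ u (z₀ + t • v) v - ⟪p, v⟫) (H v v) ?_ ?_ ?_
    · filter_upwards [hlt.eventually hd1] with t ht
      exact (ht.hasFDerivAt.comp_hasDerivAt t (hline t)).sub
        (by simpa using (hasDerivAt_id t).mul_const ⟪p, v⟫)
    · have h0 : HasFDerivAt (fderiv ℝ u) H (z₀ + (0:ℝ) • v) := by simpa using hdd.hasFDerivAt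
      have := h0.comp_hasDerivAt (0:ℝ) (hline 0)
      simpa using (this.clm_apply (hasDerivAt_const (0:ℝ) v)).sub_const ⟪p, v⟫
    · filter_upwards [hlt.eventually hc] with t ht
      simp [inner_smul_right] at ht ⊢
      linarith
  have hsymm : ∀ v w, H v w = H w v := fun v w =>
    (hu.isSymmSndFDerivAt (by simp)) v w
  refine ⟨?_, hgr.differentiableAt, ?_⟩
  · have hmax : IsLocalMax (fun z => u z - ⟪p, z⟫) z₀ := by
      filter_upwards [hc] with z hz
      rw [inner_sub_right] at hz
      linarith
    have hf : HasFDerivAt (fun z => u z - ⟪p, z⟫) (fderiv ℝ u z₀ - innerSL ℝ p) z₀ :=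
      hd1.self_of_nhds.hasFDerivAt.sub (innerSL ℝ p).hasFDerivAt
    have h0 := hmax.hasFDerivAt_eq_zero hf
    rw [sub_eq_zero] at h0
    rw [gradient, h0]
    exact (InnerProductSpace.toDual ℝ (EuclideanSpace ℝ (Fin 2))).symm_apply_apply p
  · rw [hgr.fderiv]
    set e : Fin 2 → EuclideanSpace ℝ (Fin 2) := fun i => EuclideanSpace.single i (1:ℝ) with he
    have hlap : lap u z₀ = H (e 0) (e 0) + H (e 1) (e 1) := by
      simp [lap, iteratedFDeriv_two_apply, he, hH]
    have hentry : ∀ v i, (L (H v)) i = H v (e i) := by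
      intro v i
      have h1 : ⟪L (H v), e i⟫ = H v (e i) := InnerProductSpace.toDual_symm_apply
      rw [← h1, real_inner_comm]
      have h2 : ⟪e i, L (H v)⟫ = (starRingEnd ℝ) 1 * (L (H v)) i :=
        EuclideanSpace.inner_single_left i (1:ℝ) (L (H v))
      rw [h2, map_one, one_mul]
    have hdet : (L.comp H).det
        = H (e 0) (e 0) * H (e 1) (e 1) - H (e 0) (e 1) ^ 2 := by
      rw [ContinuousLinearMap.det, ← LinearMap.det_toMatrix
        (EuclideanSpace.basisFun (Fin 2) ℝ).toBasis, Matrix.det_fin_two]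
      simp only [LinearMap.toMatrix_apply]
      simp [hentry]
      rw [hsymm (e 1) (e 0)]; ring
    rw [hdet, hlap]
    have hq : ∀ a b : ℝ, a ^ 2 * H (e 0) (e 0) + 2 * a * b * H (e 0) (e 1)
        + b ^ 2 * H (e 1) (e 1) ≤ 0 := by
      intro a b
      have := hneg (a • e 0 + b • e 1)
      simp only [map_add, map_smul, add_apply, smul_apply,
        smul_eq_mul] at this
      rw [hsymm (e 1) (e 0)] at this
      linarith
    generalize H (e 0) (e 0) = A at *
    generalize H (e 1) (e 1) = C at *
    generalize H (e 0) (e 1) = B at *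
    have hA : A ≤ 0 := by simpa using hq 1 0
    have hC : C ≤ 0 := by simpa using hq 0 1
    have hpos : 0 ≤ A * C - B ^ 2 := by
      by_contra hcon
      push Not at hcon
      rcases hA.lt_or_eq with hA' | hA'
      · have := hq B (-A)
        nlinarith
      · subst hA'
        have hB : B ≠ 0 := by rintro rfl; simp at hcon
        have h1 := hq ((1 - C) / (2 * B)) 1
        have : 2 * ((1 - C) / (2 * B)) * 1 * B = 1 - C := by field_simp
        linarith
    rw [abs_of_nonneg hpos]
    nlinarith [sq_nonneg (A - C), sq_nonneg B]

lemma radial_aux (Ω : Set (EuclideanSpace ℝ (Fin 2))) (hΩopen : IsOpen Ω)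
    (hΩdisj : Ω ∩ ball (0 : EuclideanSpace ℝ (Fin 2)) 1 = ∅) (z₀ : EuclideanSpace ℝ (Fin 2))
    (hz₀ : z₀ ∈ frontier Ω)
    (hz₀' : z₀ ∉ closure (frontier Ω \ sphere (0 : EuclideanSpace ℝ (Fin 2)) 1)) :
    ‖z₀‖ = 1 ∧ ∃ ε > 0, ∀ t : ℝ, 0 < t → t < ε → (1 + t) • z₀ ∈ Ω := by
  have hn : ‖z₀‖ = 1 := by
    by_contra h
    exact hz₀' (subset_closure ⟨hz₀, by simpa using h⟩)
  refine ⟨hn, ?_⟩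
  have hnb : (closure (frontier Ω \ sphere (0 : EuclideanSpace ℝ (Fin 2)) 1))ᶜ ∈ nhds z₀ :=
    isClosed_closure.isOpen_compl.mem_nhds hz₀'
  let F : EuclideanSpace ℝ (Fin 2) × ℝ → EuclideanSpace ℝ (Fin 2) :=
    fun q => (q.2 * ‖q.1‖⁻¹) • q.1
  have hz0ne : ‖z₀‖ ≠ 0 := by rw [hn]; exact one_ne_zero
  have hFc : ContinuousAt F (z₀, 1) := by
    refine ContinuousAt.smul (continuousAt_snd.mul (ContinuousAt.inv₀ ?_ ?_)) continuousAt_fst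
    · exact continuousAt_fst.norm
    · simpa using hz0ne
  have hF0 : F (z₀, 1) = z₀ := by simp [F, hn]
  have hFnb := hFc.preimage_mem_nhds (by rw [hF0]; exact hnb)
  obtain ⟨δ, hδ, hball⟩ := Metric.mem_nhds_iff.1 hFnb
  set η := min δ (1/2) with hη
  have hηpos : 0 < η := lt_min hδ (by norm_num)
  set K : Set (EuclideanSpace ℝ (Fin 2) × ℝ) := ball z₀ η ×ˢ Ioo 1 (1 + η) with hK
  have hKne : ∀ q ∈ K, 0 < ‖q.1‖ := by
    rintro ⟨z, s⟩ ⟨hz, -⟩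
    have h1 : ‖z₀ - z‖ < 1/2 := by
      rw [← dist_eq_norm, dist_comm]; exact lt_of_lt_of_le hz (min_le_right _ _)
    have h2 := norm_sub_norm_le z₀ z
    simp only
    linarith
  have hKnorm : ∀ q ∈ K, ‖F q‖ = q.2 := by
    intro q hq
    have h1 := hKne q hq
    have h2 : 0 < q.2 := lt_trans one_pos hq.2.1
    simp only [F, norm_smul, norm_mul, norm_inv, Real.norm_eq_abs]
    rw [abs_of_pos h2, abs_of_pos h1]
    field_simp
  have hKpre : IsPreconnected K :=
    ((convex_ball z₀ η).prod (convex_Ioo 1 (1 + η))).isPreconnected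
  have hFK : ContinuousOn F K := by
    refine ContinuousOn.smul (continuousOn_snd.mul (ContinuousOn.inv₀ continuousOn_fst.norm ?_))
      continuousOn_fst
    intro q hq
    exact (hKne q hq).ne'
  have hT : IsPreconnected (F '' K) := hKpre.image F hFK
  have hKball : K ⊆ ball (z₀, 1) δ := by
    rintro ⟨z, s⟩ ⟨hz, hs⟩
    rw [mem_ball, Prod.dist_eq, max_lt_iff]
    refine ⟨lt_of_lt_of_le hz (min_le_left _ _), ?_⟩
    have : η ≤ δ := min_le_left _ _
    simp only [Real.dist_eq]
    rw [abs_lt]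
    constructor <;> linarith [hs.1, hs.2]
  have hTfr : ∀ w ∈ F '' K, w ∉ frontier Ω := by
    rintro w ⟨q, hq, rfl⟩ hfr
    have h1 := hball (hKball hq)
    refine h1 (subset_closure ⟨hfr, ?_⟩)
    rw [mem_sphere_zero_iff_norm, hKnorm q hq]
    exact hq.2.1.ne'
  have hTsub : F '' K ⊆ Ω ∪ (closure Ω)ᶜ := by
    intro w hw
    by_cases h : w ∈ closure Ω
    · left
      by_contra h'
      exact hTfr w hw ⟨h, by rwa [hΩopen.interior_eq]⟩
    · right; exact h
  have hTne : (F '' K ∩ Ω).Nonempty := by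
    have hcl : z₀ ∈ closure Ω := hz₀.1
    obtain ⟨w, hw, hwd⟩ := Metric.mem_closure_iff.1 hcl (η / 2) (by positivity)
    have hw1 : 1 ≤ ‖w‖ := by
      by_contra h
      push Not at h
      have : w ∈ Ω ∩ ball (0 : EuclideanSpace ℝ (Fin 2)) 1 := ⟨hw, by simpa using h⟩
      rw [hΩdisj] at this
      exact this
    -- move slightly outward
    have hlim : Filter.Tendsto (fun t : ℝ => (1 + t) • w) (nhds 0) (nhds w) := by
      have : Continuous (fun t : ℝ => (1 + t) • w) := by fun_prop
      simpa using this.tendsto 0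
    have hev1 := hlim.eventually (hΩopen.mem_nhds hw)
    have hev2 := hlim.eventually (isOpen_ball.mem_nhds
      (show w ∈ ball z₀ (η/2) by rwa [mem_ball, dist_comm]))
    obtain ⟨t, ⟨ht1, ht2⟩, ht0⟩ := (((hev1.and hev2).filter_mono nhdsWithin_le_nhds).and
      (self_mem_nhdsWithin (s := Ioi (0:ℝ)))).exists
    set w' := (1 + t) • w with hw'
    have ht0' : 0 < t := ht0
    have hw'n : 1 < ‖w'‖ := by
      rw [hw', norm_smul, Real.norm_eq_abs, abs_of_pos (by linarith)]
      nlinarith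
    have hw'u : ‖w'‖ < 1 + η := by
      have := norm_sub_norm_le w' z₀
      rw [← dist_eq_norm, hn] at this
      have h3 : dist w' z₀ < η / 2 := ht2
      linarith
    refine ⟨w', ⟨(w', ‖w'‖), ⟨ball_subset_ball (by linarith) ht2, hw'n, hw'u⟩, ?_⟩, ht1⟩
    simp only [F]
    rw [mul_inv_cancel₀ (by linarith), one_smul]
  have hdisj : Disjoint Ω (closure Ω)ᶜ :=
    disjoint_compl_right.mono_left subset_closure |>.mono_right le_rfl
  have hTΩ : F '' K ⊆ Ω := hT.subset_left_of_subset_union hΩopen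
    isClosed_closure.isOpen_compl hdisj hTsub hTne
  refine ⟨η, hηpos, fun t ht0 ht => hTΩ ⟨(z₀, 1 + t), ⟨mem_ball_self hηpos, ?_, ?_⟩, ?_⟩⟩
  · simpa using ht0
  · simpa using ht
  · simp [F, hn]

lemma slope_aux (Ω : Set (EuclideanSpace ℝ (Fin 2))) (hΩopen : IsOpen Ω)
    (u : EuclideanSpace ℝ (Fin 2) → ℝ)
    (hu : ContDiffOn ℝ 2 u Ω) (huc : ContinuousOn u (closure Ω))
    (Du : EuclideanSpace ℝ (Fin 2) → EuclideanSpace ℝ (Fin 2))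
    (hDuc : ContinuousOn Du (closure Ω))
    (hDu : ∀ z ∈ Ω, Du z = gradient u z) (z₀ p : EuclideanSpace ℝ (Fin 2))
    (hz₀ : z₀ ∈ closure Ω) (ε : ℝ) (hε : 0 < ε)
    (hrad : ∀ t : ℝ, 0 < t → t < ε → (1 + t) • z₀ ∈ Ω)
    (hc : ∀ z ∈ closure Ω, u z ≤ u z₀ + ⟪p, z - z₀⟫) :
    ⟪Du z₀, z₀⟫ ≤ ⟪p, z₀⟫ := by
  by_contra hcon
  push Not at hcon
  have hγ : Continuous (fun t : ℝ => (1 + t) • z₀) := by fun_prop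
  have hmem : ∀ t ∈ Ico 0 ε, (1 + t) • z₀ ∈ closure Ω := by
    intro t ht
    rcases ht.1.eq_or_lt with h | h
    · simpa [← h] using hz₀
    · exact subset_closure (hrad t h ht.2)
  have hcD : ContinuousOn (fun t : ℝ => ⟪Du ((1 + t) • z₀), z₀⟫) (Ico 0 ε) :=
    (hDuc.comp hγ.continuousOn hmem).inner continuousOn_const
  have hcw : ContinuousWithinAt (fun t : ℝ => ⟪Du ((1 + t) • z₀), z₀⟫) (Ico 0 ε) 0 :=
    hcD 0 ⟨le_rfl, hε⟩
  have hev : ∀ᶠ t in nhdsWithin 0 (Ico 0 ε), ⟪p, z₀⟫ < ⟪Du ((1 + t) • z₀), z₀⟫ := by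
    refine hcw.eventually (lt_mem_nhds ?_)
    simpa using hcon
  obtain ⟨δ, hδ, hδs⟩ := Metric.mem_nhdsWithin_iff.1 hev
  set τ := min δ ε / 2 with hτ
  have hm : 0 < min δ ε := lt_min hδ hε
  have hτ0 : 0 < τ := by positivity
  have hτδ : τ < δ := by linarith [min_le_left δ ε]
  have hτε : τ < ε := by linarith [min_le_right δ ε]
  have hderiv : ∀ t ∈ Ioo 0 τ, HasDerivAt (fun t : ℝ => u ((1 + t) • z₀))
      ⟪Du ((1 + t) • z₀), z₀⟫ t := by
    intro t ht
    have hin := hrad t ht.1 (ht.2.trans hτε)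
    have hd : DifferentiableAt ℝ u ((1 + t) • z₀) :=
      (hu.contDiffAt (hΩopen.mem_nhds hin)).differentiableAt (by simp)
    have hl : HasDerivAt (fun t : ℝ => (1 + t) • z₀) z₀ t := by
      simpa using ((hasDerivAt_id t).const_add 1).smul_const z₀
    have := hd.hasFDerivAt.comp_hasDerivAt t hl
    rw [hDu _ hin, gradient, InnerProductSpace.toDual_symm_apply]
    exact this
  obtain ⟨s, hs, hseq⟩ := exists_hasDerivAt_eq_slope (fun t : ℝ => u ((1 + t) • z₀)) _ hτ0
    (huc.comp hγ.continuousOn fun t ht => hmem t ⟨ht.1, ht.2.trans_lt hτε⟩) hderiv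
  have h1 : ⟪p, z₀⟫ < ⟪Du ((1 + s) • z₀), z₀⟫ := by
    refine hδs ⟨?_, hs.1.le, hs.2.trans hτε⟩
    rw [mem_ball, Real.dist_eq, sub_zero, abs_of_pos hs.1]
    exact hs.2.trans hτδ
  rw [hseq] at h1
  have h2 := hc _ (hmem τ ⟨hτ0.le, hτε⟩)
  rw [add_smul, one_smul, add_sub_cancel_left, inner_smul_right] at h2
  rw [lt_div_iff₀ (by linarith)] at h1
  simp [add_smul] at h1
  linarith

lemma push_aux (Ω : Set (EuclideanSpace ℝ (Fin 2))) (hΩopen : IsOpen Ω)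
    (w : EuclideanSpace ℝ (Fin 2)) (hw : w ∈ Ω) (hw0 : 0 < ‖w‖) :
    ∃ w' ∈ Ω, ‖w‖ < ‖w'‖ := by
  have hlim : Filter.Tendsto (fun t : ℝ => (1 + t) • w) (nhds 0) (nhds w) := by
    have : Continuous (fun t : ℝ => (1 + t) • w) := by fun_prop
    simpa using this.tendsto 0
  have hev1 := hlim.eventually (hΩopen.mem_nhds hw)
  obtain ⟨t, ht1, ht0⟩ := ((hev1.filter_mono nhdsWithin_le_nhds).and
    (self_mem_nhdsWithin (s := Ioi (0:ℝ)))).exists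
  have ht0' : 0 < t := ht0
  refine ⟨_, ht1, ?_⟩
  rw [norm_smul, Real.norm_eq_abs, abs_of_pos (by linarith)]
  nlinarith

lemma sigma_nonempty (Ω : Set (EuclideanSpace ℝ (Fin 2)))
    (hΩopen : IsOpen Ω) (hΩne : Ω.Nonempty) (hΩbdd : Bornology.IsBounded Ω)
    (hΩdisj : Ω ∩ Metric.ball (0 : EuclideanSpace ℝ (Fin 2)) 1 = ∅) :
    (frontier Ω \ Metric.sphere (0 : EuclideanSpace ℝ (Fin 2)) 1).Nonempty := by
  obtain ⟨w, hw⟩ := hΩne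
  have hw1 : 1 ≤ ‖w‖ := by
    by_contra h
    push Not at h
    have : w ∈ Ω ∩ ball (0 : EuclideanSpace ℝ (Fin 2)) 1 := ⟨hw, by simpa using h⟩
    rw [hΩdisj] at this
    exact this
  obtain ⟨w', hw', hlt⟩ := push_aux Ω hΩopen w hw (by linarith)
  obtain ⟨z, hz, hmax⟩ := hΩbdd.isCompact_closure.exists_isMaxOn ⟨w, subset_closure hw⟩
    (continuous_norm.continuousOn (s := closure Ω))
  have h1 : ‖w'‖ ≤ ‖z‖ := hmax (subset_closure hw')
  refine ⟨z, ⟨hz, ?_⟩, ?_⟩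
  · rw [hΩopen.interior_eq]
    intro hzΩ
    obtain ⟨z', hz', hlt'⟩ := push_aux Ω hΩopen z hzΩ (by linarith)
    have : ‖z'‖ ≤ ‖z‖ := hmax (subset_closure hz')
    linarith
  · rw [mem_sphere_zero_iff_norm]
    intro h
    linarith

lemma gamma_measurable (Ω : Set (EuclideanSpace ℝ (Fin 2))) (hΩopen : IsOpen Ω)
    (u : EuclideanSpace ℝ (Fin 2) → ℝ) (huc : ContinuousOn u (closure Ω))
    (Du : EuclideanSpace ℝ (Fin 2) → EuclideanSpace ℝ (Fin 2))
    (hDuc : ContinuousOn Du (closure Ω)) :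
    MeasurableSet {z₀ ∈ Ω | ∀ z ∈ closure Ω, u z ≤ u z₀ + ⟪Du z₀, z - z₀⟫} := by
  have hcl : IsClosed {z₀ ∈ closure Ω | ∀ z ∈ closure Ω, u z ≤ u z₀ + ⟪Du z₀, z - z₀⟫} := by
    have : {z₀ ∈ closure Ω | ∀ z ∈ closure Ω, u z ≤ u z₀ + ⟪Du z₀, z - z₀⟫}
        = closure Ω ∩ ⋂ z ∈ closure Ω, {z₀ ∈ closure Ω | u z ≤ u z₀ + ⟪Du z₀, z - z₀⟫} := by
      ext x
      simp only [mem_ofPred_eq, mem_inter_iff, mem_iInter]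
      constructor
      · rintro ⟨h1, h2⟩
        exact ⟨h1, fun z hz => ⟨h1, h2 z hz⟩⟩
      · rintro ⟨h1, h2⟩
        exact ⟨h1, fun z hz => (h2 z hz).2⟩
    rw [this]
    refine isClosed_closure.inter (isClosed_biInter fun z _ => ?_)
    exact isClosed_closure.isClosed_le continuousOn_const
      (huc.add (hDuc.inner (continuousOn_const.sub continuousOn_id)))
  have : {z₀ ∈ Ω | ∀ z ∈ closure Ω, u z ≤ u z₀ + ⟪Du z₀, z - z₀⟫} =
      Ω ∩ {z₀ ∈ closure Ω | ∀ z ∈ closure Ω, u z ≤ u z₀ + ⟪Du z₀, z - z₀⟫} := by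
    ext x
    simp only [mem_ofPred_eq, mem_inter_iff]
    exact ⟨fun h => ⟨h.1, subset_closure h.1, h.2⟩, fun h => ⟨h.1, h.2.2⟩⟩
  rw [this]
  exact hΩopen.measurableSet.inter hcl.measurableSet

/-- If neither `p` nor `-p` is attained in the interior, the contact point `a` of `p` maximizes
`u + |p · z|`. -/
lemma exceptional_aux {E : Type*} [NormedAddCommGroup E] [InnerProductSpace ℝ E] (K : Set E)
    (u : E → ℝ) (p a b : E) (haK : a ∈ K) (hbK : b ∈ K)
    (ha : ∀ z ∈ K, u z ≤ u a + ⟪p, z - a⟫) (hb : ∀ z ∈ K, u z ≤ u b + ⟪-p, z - b⟫)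
    (hpa : 0 ≤ ⟪p, a⟫) (hpb : 0 ≤ ⟪-p, b⟫) :
    ∀ z ∈ K, u z + |⟪p, z⟫| ≤ u a := by
  simp only [inner_sub_right, inner_neg_left] at *
  have h1 := ha b hbK
  have h2 := hb a haK
  intro z hz
  have h3 := ha z hz
  have h4 := hb z hz
  rcases abs_cases ⟪p, z⟫ with h | h <;> linarith

/-- "Claim 2": the integral estimate over the upper contact set
Γ_u.  The possibly infinite right-hand side is formalized as a lower Lebesgue
integral in `ℝ≥0∞`, and the signed interval integral on the left-hand side is
mapped into `ℝ≥0∞` by `ENNReal.ofReal`. -/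
theorem stmt_3
    (Ω : Set (EuclideanSpace ℝ (Fin 2)))
    (hΩopen : IsOpen Ω) (hΩne : Ω.Nonempty) (hΩbdd : Bornology.IsBounded Ω)
    (hΩdisj : Ω ∩ Metric.ball (0 : EuclideanSpace ℝ (Fin 2)) 1 = ∅)
    (Sg Sg' : Set (EuclideanSpace ℝ (Fin 2)))
    (hSg : Sg = closure (frontier Ω \ Metric.sphere (0 : EuclideanSpace ℝ (Fin 2)) 1))
    (hSg' : Sg' = frontier Ω \ Sg)
    (g : ℝ → ℝ) (hg : ContinuousOn g (Ici 0)) (hgnn : ∀ ρ ∈ Ici (0:ℝ), 0 ≤ g ρ)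
    (u : EuclideanSpace ℝ (Fin 2) → ℝ)
    -- u ∈ C²(Ω) ∩ C¹(Ω̄): u is C² in Ω and its gradient extends continuously
    -- (as Du) to the closure of Ω
    (hu : ContDiffOn ℝ 2 u Ω) (huc : ContinuousOn u (closure Ω))
    (Du : EuclideanSpace ℝ (Fin 2) → EuclideanSpace ℝ (Fin 2))
    (hDuc : ContinuousOn Du (closure Ω))
    (hDu : ∀ z ∈ Ω, Du z = gradient u z)
    -- the Neumann condition ∂u/∂r ≥ 0 on Σ'
    (hneu : ∀ z ∈ Sg', 0 ≤ ⟪Du z, z⟫)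
    (M : ℝ) (hM : M = (sSup (u '' Ω) - sSup (u '' Sg)) / Metric.diam Ω)
    -- the upper contact set of u
    (Γu : Set (EuclideanSpace ℝ (Fin 2)))
    (hΓu : Γu = {z₀ ∈ Ω | ∃ p : EuclideanSpace ℝ (Fin 2),
      ∀ z ∈ closure Ω, u z ≤ u z₀ + ⟪p, z - z₀⟫}) :
    ENNReal.ofReal (∫ ρ in (0:ℝ)..M, g ρ * ρ)
      ≤ ENNReal.ofReal (1 / (4 * Real.pi)) *
        ∫⁻ z in Γu, ENNReal.ofReal (g ‖gradient u z‖ * (lap u z) ^ 2) := by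
  classical
  have hcomp : IsCompact (closure Ω) := hΩbdd.isCompact_closure
  have hclne : (closure Ω).Nonempty := hΩne.closure
  have hSgsub : Sg ⊆ closure Ω := by
    rw [hSg]
    exact closure_minimal (fun x hx => hx.1.1) isClosed_closure
  have hSgne : Sg.Nonempty := by
    rw [hSg]
    exact (sigma_nonempty Ω hΩopen hΩne hΩbdd hΩdisj).closure
  have hbddcl : BddAbove (u '' closure Ω) := (hcomp.image_of_continuousOn huc).bddAbove
  have hbddΩ : BddAbove (u '' Ω) := hbddcl.mono (image_mono subset_closure)
  have hbddS : BddAbove (u '' Sg) := hbddcl.mono (image_mono hSgsub)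
  have hcl_le : ∀ z ∈ closure Ω, u z ≤ sSup (u '' Ω) := by
    intro z hz
    have hclosed : IsClosed {x ∈ closure Ω | u x ≤ sSup (u '' Ω)} :=
      isClosed_closure.isClosed_le huc continuousOn_const
    have : closure Ω ⊆ {x ∈ closure Ω | u x ≤ sSup (u '' Ω)} :=
      closure_minimal (fun x hx => ⟨subset_closure hx, le_csSup hbddΩ (mem_image_of_mem u hx)⟩)
        hclosed
    exact (this hz).2
  have hM0 : 0 ≤ M := by
    rw [hM]
    refine div_nonneg (sub_nonneg.2 (csSup_le (hSgne.image u) ?_)) diam_nonneg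
    rintro _ ⟨z, hz, rfl⟩
    exact hcl_le z (hSgsub hz)
  rcases hM0.eq_or_lt with hM1 | hMpos
  · rw [← hM1]
    simp
  have hd : 0 < diam Ω := by
    rcases (diam_nonneg (s := Ω)).eq_or_lt with h | h
    · rw [← h, div_zero] at hM
      linarith
    · exact h
  have hMd : M * diam Ω = sSup (u '' Ω) - sSup (u '' Sg) := by
    rw [hM, div_mul_cancel₀ _ hd.ne']
  have hcontact : ∀ z₀ ∈ Ω, ∀ p : EuclideanSpace ℝ (Fin 2),
      (∀ z ∈ closure Ω, u z ≤ u z₀ + ⟪p, z - z₀⟫) →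
      gradient u z₀ = p ∧ DifferentiableAt ℝ (gradient u) z₀ ∧
        |(fderiv ℝ (gradient u) z₀).det| ≤ (lap u z₀) ^ 2 / 4 := by
    intro z₀ hz₀ p hp
    refine contact_aux u z₀ p (hu.contDiffAt (hΩopen.mem_nhds hz₀)) ?_
    filter_upwards [hΩopen.mem_nhds hz₀] with z hz using hp z (subset_closure hz)
  have hΓeq : Γu = {z₀ ∈ Ω | ∀ z ∈ closure Ω, u z ≤ u z₀ + ⟪Du z₀, z - z₀⟫} := by
    rw [hΓu]
    ext z₀
    constructor
    · rintro ⟨h1, p, hp⟩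
      refine ⟨h1, ?_⟩
      rw [hDu z₀ h1, (hcontact z₀ h1 p hp).1]
      exact hp
    · rintro ⟨h1, h2⟩
      exact ⟨h1, Du z₀, h2⟩
  have hΓm : MeasurableSet Γu := by
    rw [hΓeq]
    exact gamma_measurable Ω hΩopen u huc Du hDuc
  -- every slope is attained in the domain or on the spherical part
  have hmaxpt : ∀ p : EuclideanSpace ℝ (Fin 2), ‖p‖ < M → p ∉ gradient u '' Γu →
      ∃ a ∈ closure Ω, ‖a‖ = 1 ∧ (∀ z ∈ closure Ω, u z ≤ u a + ⟪p, z - a⟫) ∧ 0 ≤ ⟪p, a⟫ := by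
    intro p hp hpA
    obtain ⟨a, ha, hamax⟩ := hcomp.exists_isMaxOn hclne
      (f := fun z => u z - ⟪p, z⟫) (huc.sub (continuousOn_const.inner continuousOn_id))
    have hac : ∀ z ∈ closure Ω, u z ≤ u a + ⟪p, z - a⟫ := by
      intro z hz
      have : u z - ⟪p, z⟫ ≤ u a - ⟪p, a⟫ := hamax hz
      rw [inner_sub_right]
      linarith
    have haΩ : a ∉ Ω := by
      intro h
      refine hpA ⟨a, ?_, (hcontact a h p hac).1⟩
      rw [hΓu]
      exact ⟨h, p, hac⟩
    have hfr : a ∈ frontier Ω := ⟨ha, by rwa [hΩopen.interior_eq]⟩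
    have haS : a ∉ Sg := by
      intro h
      have h1 : u a ≤ sSup (u '' Sg) := le_csSup hbddS (mem_image_of_mem u h)
      have h2 : sSup (u '' Ω) ≤ u a + ‖p‖ * diam Ω := by
        refine csSup_le (hΩne.image u) ?_
        rintro _ ⟨z, hz, rfl⟩
        have h3 := hac z (subset_closure hz)
        have h4 := real_inner_le_norm p (z - a)
        have h5 : ‖z - a‖ ≤ diam Ω := by
          rw [← dist_eq_norm, ← diam_closure]
          exact dist_le_diam_of_mem hΩbdd.closure (subset_closure hz) ha
        have h6 := mul_le_mul_of_nonneg_left h5 (norm_nonneg p)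
        linarith
      have h7 := mul_lt_mul_of_pos_right hp hd
      linarith
    obtain ⟨hn, ε, hε, hrad⟩ := radial_aux Ω hΩopen hΩdisj a hfr (hSg ▸ haS)
    have h1 := slope_aux Ω hΩopen u hu huc Du hDuc hDu a p ha ε hε hrad hac
    have h2 := hneu a (by rw [hSg']; exact ⟨hfr, haS⟩)
    exact ⟨a, ha, hn, hac, h2.trans h1⟩
  set A := gradient u '' Γu with hA
  set N : Set (EuclideanSpace ℝ (Fin 2)) := {p | ‖p‖ < M ∧ p ∉ A ∧ -p ∉ A} with hN
  have hNex : ∀ p ∈ N, ∃ a ∈ closure Ω, ‖a‖ = 1 ∧ ∀ z ∈ closure Ω, u z + |⟪p, z⟫| ≤ u a := by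
    rintro p ⟨hp, hpA, hpA'⟩
    obtain ⟨a, ha, han, hac, hpa⟩ := hmaxpt p hp hpA
    obtain ⟨b, hb, -, hbc, hpb⟩ := hmaxpt (-p) (by simpa using hp) hpA'
    exact ⟨a, ha, han, exceptional_aux (closure Ω) u p a b ha hb hac hbc hpa hpb⟩
  have hN0 : volume N = 0 := by
    rcases N.eq_empty_or_nonempty with h | ⟨p₀, hp₀⟩
    · rw [h, measure_empty]
    obtain ⟨a, ha, han, hac⟩ := hNex p₀ hp₀
    have hsub : N ⊆ ((LinearMap.ker (innerSL ℝ a : EuclideanSpace ℝ (Fin 2) →ₗ[ℝ] ℝ) :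
        Submodule ℝ (EuclideanSpace ℝ (Fin 2))) : Set (EuclideanSpace ℝ (Fin 2))) := by
      intro q hq
      obtain ⟨b, hb, -, hbc⟩ := hNex q hq
      have h1 := hbc a ha
      have h2 := hac b hb
      have h3 := abs_nonneg ⟪p₀, b⟫
      have h4 : |⟪q, a⟫| = 0 := le_antisymm (by linarith) (abs_nonneg _)
      have h5 : ⟪a, q⟫ = 0 := by rw [real_inner_comm]; exact abs_eq_zero.1 h4
      simpa using h5
    refine measure_mono_null hsub (Measure.addHaar_submodule _ _ ?_)
    intro htop
    have : a ∈ LinearMap.ker (innerSL ℝ a : EuclideanSpace ℝ (Fin 2) →ₗ[ℝ] ℝ) := by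
      rw [htop]; trivial
    have h0 : ⟪a, a⟫ = 0 := by simpa using this
    rw [real_inner_self_eq_norm_sq, han] at h0
    norm_num at h0
  -- the weight
  set G : EuclideanSpace ℝ (Fin 2) → ENNReal := fun p => ENNReal.ofReal (g ‖p‖) with hG
  have hGm : Measurable G := by
    have hcont : Continuous (fun p : EuclideanSpace ℝ (Fin 2) => g ‖p‖) :=
      hg.comp_continuous continuous_norm (fun x => norm_nonneg x)
    exact hcont.measurable.ennreal_ofReal
  have hnegA : ∫⁻ p in (fun p => -p) ⁻¹' A, G p = ∫⁻ p in A, G p := by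
    have := (Measure.measurePreserving_neg
      (volume : Measure (EuclideanSpace ℝ (Fin 2)))).setLIntegral_comp_preimage_emb
      (MeasurableEquiv.neg (EuclideanSpace ℝ (Fin 2))).measurableEmbedding G A
    rw [← this]
    refine lintegral_congr fun p => ?_
    have h : G (-p) = G p := by simp only [hG, norm_neg]
    exact h.symm
  have hball : ∫⁻ p in ball (0 : EuclideanSpace ℝ (Fin 2)) M, G p ≤ 2 * ∫⁻ p in A, G p := by
    have hsub : ball (0 : EuclideanSpace ℝ (Fin 2)) M ⊆ (A ∪ (fun p => -p) ⁻¹' A) ∪ N := by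
      intro p hp
      by_cases h1 : p ∈ A
      · exact Or.inl (Or.inl h1)
      by_cases h2 : -p ∈ A
      · exact Or.inl (Or.inr h2)
      · exact Or.inr ⟨by simpa using hp, h1, h2⟩
    calc _ ≤ ∫⁻ p in (A ∪ (fun p => -p) ⁻¹' A) ∪ N, G p := lintegral_mono_set hsub
      _ ≤ (∫⁻ p in A ∪ (fun p => -p) ⁻¹' A, G p) + ∫⁻ p in N, G p := lintegral_union_le _ _ _
      _ = ∫⁻ p in A ∪ (fun p => -p) ⁻¹' A, G p := by
        rw [Measure.restrict_eq_zero.2 hN0]; simp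
      _ ≤ (∫⁻ p in A, G p) + ∫⁻ p in (fun p => -p) ⁻¹' A, G p := lintegral_union_le _ _ _
      _ = 2 * ∫⁻ p in A, G p := by rw [hnegA, two_mul]
  have hΓc : ∀ z ∈ Γu, DifferentiableAt ℝ (gradient u) z ∧
        |(fderiv ℝ (gradient u) z).det| ≤ (lap u z) ^ 2 / 4 := by
    intro z hz
    rw [hΓu] at hz
    obtain ⟨h1, p, hp⟩ := hz
    exact (hcontact z h1 p hp).2
  have harea : ∫⁻ p in A, G p ≤ ENNReal.ofReal (1 / 4) *
      ∫⁻ z in Γu, ENNReal.ofReal (g ‖gradient u z‖ * (lap u z) ^ 2) := by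
    refine (area_aux' volume Γu hΓm (gradient u) (fun z => fderiv ℝ (gradient u) z)
      (fun z hz => (hΓc z hz).1.hasFDerivAt.hasFDerivWithinAt) G hGm).trans ?_
    rw [← lintegral_const_mul' _ _ ENNReal.ofReal_ne_top]
    refine setLIntegral_mono' hΓm fun z hz => ?_
    simp only [hG]
    rw [← ENNReal.ofReal_mul (abs_nonneg _), ← ENNReal.ofReal_mul (by norm_num)]
    refine ENNReal.ofReal_le_ofReal ?_
    have h1 := mul_le_mul_of_nonneg_right (hΓc z hz).2 (hgnn ‖gradient u z‖ (norm_nonneg _))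
    linarith
  have hpol := polar_aux g hg hgnn M hMpos
  have hfin : ENNReal.ofReal (2 * Real.pi * ∫ ρ in (0:ℝ)..M, g ρ * ρ) ≤
      2 * (ENNReal.ofReal (1 / 4) *
      ∫⁻ z in Γu, ENNReal.ofReal (g ‖gradient u z‖ * (lap u z) ^ 2)) := by
    rw [← hpol]
    exact hball.trans (mul_le_mul_right harea 2)
  have hpi := Real.pi_pos
  calc ENNReal.ofReal (∫ ρ in (0:ℝ)..M, g ρ * ρ)
      = ENNReal.ofReal (1 / (2 * Real.pi)) *
          ENNReal.ofReal (2 * Real.pi * ∫ ρ in (0:ℝ)..M, g ρ * ρ) := by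
        rw [← ENNReal.ofReal_mul (by positivity)]
        congr 1
        field_simp
    _ ≤ ENNReal.ofReal (1 / (2 * Real.pi)) * (2 * (ENNReal.ofReal (1 / 4) *
      ∫⁻ z in Γu, ENNReal.ofReal (g ‖gradient u z‖ * (lap u z) ^ 2))) :=
        mul_le_mul_right hfin _
    _ = _ := by
        have h2 : ENNReal.ofReal (1 / (2 * Real.pi)) * 2 * ENNReal.ofReal (1 / 4)
            = ENNReal.ofReal (1 / (4 * Real.pi)) := by
          rw [← ENNReal.ofReal_ofNat 2,
            ← ENNReal.ofReal_mul (by positivity), ← ENNReal.ofReal_mul (by positivity)]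
          congr 1
          field_simp
        rw [← mul_assoc, ← mul_assoc, h2]
end

section
/- Let H be a real inner product space and let p, w : [0,1] → H be continuous. Set E := ∫₀¹ ‖w(t)‖² dt. Then ∫₀¹ ⟨p(t), w(t)⟩ dt − √E · ∫₀¹ ½(‖p(t)‖² − 1) dt ≤ √E, with equality if and only if √E · p(t) = w(t) for all t ∈ [0,1]; and ∫₀¹ ⟨p(t), w(t)⟩ dt + √E · ∫₀¹ ½(‖p(t)‖² − 1) dt ≥ −√E, with equality if and only if √E · p(t) = −w(t) for all t ∈ [0,1]. -/
open Set RealInnerProductSpace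

theorem zero_of_integral_sq {H : Type*} [NormedAddCommGroup H] [InnerProductSpace ℝ H]
    (w : ℝ → H) (hw : ContinuousOn w (Icc 0 1)) (h : (∫ t in (0:ℝ)..1, ‖w t‖^2) = 0) :
    ∀ t ∈ Icc (0:ℝ) 1, w t = 0 := by
  intro t ht
  by_contra hne
  have := intervalIntegral.integral_pos (f := fun t => ‖w t‖^2) (zero_lt_one (α := ℝ))
    (hw.norm.pow 2) (fun x _ => by positivity) ⟨t, ht, by positivity⟩
  linarith

theorem half_aux {H : Type*} [NormedAddCommGroup H] [InnerProductSpace ℝ H]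
    (p w : ℝ → H)
    (hp : ContinuousOn p (Icc 0 1)) (hw : ContinuousOn w (Icc 0 1))
    (E : ℝ) (hE : E = ∫ t in (0:ℝ)..1, ‖w t‖^2) :
    ((∫ t in (0:ℝ)..1, ⟪p t, w t⟫)
        - Real.sqrt E * ∫ t in (0:ℝ)..1, (‖p t‖^2 - 1)/2 ≤ Real.sqrt E) ∧
    ((∫ t in (0:ℝ)..1, ⟪p t, w t⟫)
        - Real.sqrt E * ∫ t in (0:ℝ)..1, (‖p t‖^2 - 1)/2 = Real.sqrt E ↔
      ∀ t ∈ Icc (0:ℝ) 1, Real.sqrt E • p t = w t) := by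
  have hE0 : 0 ≤ E := by
    rw [hE]
    exact intervalIntegral.integral_nonneg zero_le_one (fun t _ => by positivity)
  have hs0 : 0 ≤ Real.sqrt E := Real.sqrt_nonneg E
  have hss : Real.sqrt E * Real.sqrt E = E := Real.mul_self_sqrt hE0
  generalize Real.sqrt E = s at *
  have hu : uIcc (0:ℝ) 1 = Icc 0 1 := uIcc_of_le zero_le_one
  have iw : IntervalIntegrable (fun t => ‖w t‖^2) MeasureTheory.volume 0 1 :=
    ContinuousOn.intervalIntegrable (by rw [hu]; exact hw.norm.pow 2)
  have ip : IntervalIntegrable (fun t => (‖p t‖^2 - 1)/2) MeasureTheory.volume 0 1 :=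
    ContinuousOn.intervalIntegrable
      (by rw [hu]; exact ((hp.norm.pow 2).sub continuousOn_const).div_const 2)
  have ii : IntervalIntegrable (fun t => ⟪p t, w t⟫) MeasureTheory.volume 0 1 :=
    ContinuousOn.intervalIntegrable (by rw [hu]; exact hp.inner hw)
  have hd : ContinuousOn (fun t => s • p t - w t) (Icc 0 1) := (hp.const_smul s).sub hw
  have key : (∫ t in (0:ℝ)..1, ‖s • p t - w t‖^2) =
      2 * s * (s - ((∫ t in (0:ℝ)..1, ⟪p t, w t⟫) - s * ∫ t in (0:ℝ)..1, (‖p t‖^2 - 1)/2)) := by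
    have h1 : ∀ t, ‖s • p t - w t‖^2 =
        ((2 * s^2) * ((‖p t‖^2 - 1)/2) - (2 * s) * ⟪p t, w t⟫ + ‖w t‖^2) + s^2 := by
      intro t
      rw [norm_sub_sq_real, norm_smul, real_inner_smul_left, mul_pow, Real.norm_eq_abs, sq_abs]
      ring
    simp_rw [h1]
    rw [intervalIntegral.integral_add (((ip.const_mul _).sub (ii.const_mul _)).add iw)
        intervalIntegrable_const,
      intervalIntegral.integral_add ((ip.const_mul _).sub (ii.const_mul _)) iw,
      intervalIntegral.integral_sub (ip.const_mul _) (ii.const_mul _),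
      intervalIntegral.integral_const_mul, intervalIntegral.integral_const_mul, ← hE,
      intervalIntegral.integral_const, ← hss]
    simp only [sub_zero, one_smul]
    ring
  have hnn : 0 ≤ ∫ t in (0:ℝ)..1, ‖s • p t - w t‖^2 :=
    intervalIntegral.integral_nonneg zero_le_one (fun t _ => by positivity)
  rcases hs0.eq_or_lt with h0 | hpos
  · subst h0
    have hw0 := zero_of_integral_sq w hw (by rw [← hE, ← hss]; ring)
    have hI : (∫ t in (0:ℝ)..1, ⟪p t, w t⟫) = 0 := by
      rw [intervalIntegral.integral_congr (g := fun _ => (0:ℝ))]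
      · simp
      · intro t ht
        rw [hu] at ht
        simp [hw0 t ht]
    rw [hI]
    refine ⟨by simp, fun _ => ?_, fun _ => by simp⟩
    intro t ht
    simp [hw0 t ht]
  · rw [key] at hnn
    refine ⟨?_, ?_, ?_⟩
    · have := nonneg_of_mul_nonneg_right hnn (by positivity)
      linarith
    · intro h t ht
      have := zero_of_integral_sq _ hd (by rw [key, h]; ring) t ht
      exact sub_eq_zero.mp this
    · intro h
      have h0 : (∫ t in (0:ℝ)..1, ‖s • p t - w t‖^2) = 0 := by
        rw [intervalIntegral.integral_congr (g := fun _ => (0:ℝ))]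
        · simp
        · intro t ht
          rw [hu] at ht
          simp [h t ht]
      rw [key] at h0
      rcases mul_eq_zero.mp h0 with h2 | h2 <;> linarith

/-- comparison between the Rabinowitz action and the geodesic
energy, fiberwise formulation. -/
theorem stmt_5 {H : Type*} [NormedAddCommGroup H] [InnerProductSpace ℝ H]
    (p w : ℝ → H)
    (hp : ContinuousOn p (Icc 0 1)) (hw : ContinuousOn w (Icc 0 1))
    (E : ℝ) (hE : E = ∫ t in (0:ℝ)..1, ‖w t‖^2) :
    ((∫ t in (0:ℝ)..1, ⟪p t, w t⟫)
        - Real.sqrt E * ∫ t in (0:ℝ)..1, (‖p t‖^2 - 1)/2 ≤ Real.sqrt E) ∧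
    ((∫ t in (0:ℝ)..1, ⟪p t, w t⟫)
        - Real.sqrt E * ∫ t in (0:ℝ)..1, (‖p t‖^2 - 1)/2 = Real.sqrt E ↔
      ∀ t ∈ Icc (0:ℝ) 1, Real.sqrt E • p t = w t) ∧
    (-Real.sqrt E ≤ (∫ t in (0:ℝ)..1, ⟪p t, w t⟫)
        + Real.sqrt E * ∫ t in (0:ℝ)..1, (‖p t‖^2 - 1)/2) ∧
    ((∫ t in (0:ℝ)..1, ⟪p t, w t⟫)
        + Real.sqrt E * ∫ t in (0:ℝ)..1, (‖p t‖^2 - 1)/2 = -Real.sqrt E ↔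
      ∀ t ∈ Icc (0:ℝ) 1, Real.sqrt E • p t = -w t) := by
  obtain ⟨a, b⟩ := half_aux p w hp hw E hE
  obtain ⟨c, d⟩ := half_aux p (fun t => - w t) hp hw.neg E (by simpa using hE)
  simp only [inner_neg_right, intervalIntegral.integral_neg] at c d
  refine ⟨a, b, by linarith, ?_⟩
  rw [← d]
  constructor <;> intro h <;> linarith
end

section
/- Let χ : ℝ → ℝ be twice differentiable with χ(s) = s for all s ≤ 1, χ(s) = 2 for all s ≥ 3, 0 ≤ χ'(s) ≤ 1 and −1 ≤ χ''(s) ≤ 0 for all s ∈ ℝ, and let κ ∈ ℝ satisfy (2s+1)³ χ''(s)² + (2s+1) χ'(s)² ≤ κ for all s ∈ ℝ. Fix ε ∈ (0, 1], define h₁(ρ) := ½(ρ² − 1) and h₀(ρ) := (1/ε) χ(ε h₁(ρ)) for ρ > 0. Then for every ρ > 0: h₀'(ρ)² ≤ κ (h₀(ρ) + 1) and ρ² h₀''(ρ)² ≤ κ (h₀(ρ) + 1). -/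
theorem deriv_eq_of_eq_Iic (f g : ℝ → ℝ) (hf : Differentiable ℝ f) (hg : Differentiable ℝ g)
    (h : ∀ s : ℝ, s ≤ 1 → f s = g s) (s : ℝ) (hs : s ≤ 1) : deriv f s = deriv g s := by
  have h1 : HasDerivWithinAt f (deriv f s) (Set.Iic 1) s := (hf s).hasDerivAt.hasDerivWithinAt
  have h2 : HasDerivWithinAt f (deriv g s) (Set.Iic 1) s :=
    ((hg s).hasDerivAt.hasDerivWithinAt).congr (fun x hx => h x hx) (h s hs)
  exact (uniqueDiffOn_Iic (1 : ℝ) s hs).eq_deriv _ h1 h2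

/-- the truncated Hamiltonian profile h₀ satisfies the growth
conditions (c') of the a priori L^∞ estimate. -/
theorem stmt_8 (χ : ℝ → ℝ)
    (hχ1 : Differentiable ℝ χ) (hχ2 : Differentiable ℝ (deriv χ))
    (hlow : ∀ s : ℝ, s ≤ 1 → χ s = s)
    (hhigh : ∀ s : ℝ, 3 ≤ s → χ s = 2)
    (hχ'0 : ∀ s : ℝ, 0 ≤ deriv χ s) (hχ'1 : ∀ s : ℝ, deriv χ s ≤ 1)
    (hχ''0 : ∀ s : ℝ, deriv (deriv χ) s ≤ 0) (hχ''1 : ∀ s : ℝ, -1 ≤ deriv (deriv χ) s)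
    (κ : ℝ)
    (hκ : ∀ s : ℝ, (2*s+1)^3 * (deriv (deriv χ) s)^2 + (2*s+1) * (deriv χ s)^2 ≤ κ)
    (ε : ℝ) (hε0 : 0 < ε) (hε1 : ε ≤ 1)
    (h₁ h₀ : ℝ → ℝ)
    (hh₁ : ∀ ρ : ℝ, h₁ ρ = (ρ^2 - 1)/2)
    (hh₀ : ∀ ρ : ℝ, h₀ ρ = (1/ε) * χ (ε * h₁ ρ)) :
    ∀ ρ : ℝ, 0 < ρ →
      (deriv h₀ ρ)^2 ≤ κ * (h₀ ρ + 1) ∧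
      ρ^2 * (deriv (deriv h₀) ρ)^2 ≤ κ * (h₀ ρ + 1) := by
  have hd1 : ∀ s : ℝ, s ≤ 1 → deriv χ s = 1 := by
    intro s hs
    rw [deriv_eq_of_eq_Iic χ (fun x => x) hχ1 differentiable_id hlow s hs]
    simp
  have hd2 : ∀ s : ℝ, s ≤ 1 → deriv (deriv χ) s = 0 := by
    intro s hs
    rw [deriv_eq_of_eq_Iic (deriv χ) (fun _ => 1) hχ2 (differentiable_const _) hd1 s hs]
    simp
  have hκ3 : 3 ≤ κ := by
    have := hκ 1
    rw [hd1 1 le_rfl, hd2 1 le_rfl] at this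
    linarith
  have hmono : Monotone χ := monotone_of_deriv_nonneg hχ1 hχ'0
  have hin : ∀ x : ℝ, HasDerivAt (fun y : ℝ => ε * ((y^2 - 1)/2)) (ε * x) x := by
    intro x
    have := ((((hasDerivAt_id x).pow 2).sub_const 1).div_const 2).const_mul ε
    have e : ε * x = ε * (((2 : ℕ) : ℝ) * id x ^ (2 - 1) * 1 / 2) := by simp
    rw [e]
    exact this
  have hfun : h₀ = fun y => (1/ε) * χ (ε * ((y^2 - 1)/2)) := by
    funext y
    rw [hh₀, hh₁]
  have hD1 : deriv h₀ = fun x => x * deriv χ (ε * ((x^2 - 1)/2)) := by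
    funext x
    have h := (HasDerivAt.comp x (hχ1 (ε * ((x^2 - 1)/2))).hasDerivAt (hin x)).const_mul (1/ε)
    have h' : HasDerivAt h₀ (1 / ε * (deriv χ (ε * ((x ^ 2 - 1) / 2)) * (ε * x))) x := by
      rw [hfun]
      exact h
    rw [h'.deriv]
    field_simp
  have hD2 : ∀ x, deriv (deriv h₀) x = deriv χ (ε * ((x^2 - 1)/2))
      + x * (deriv (deriv χ) (ε * ((x^2 - 1)/2)) * (ε * x)) := by
    intro x
    have h := (hasDerivAt_id x).mul
      (HasDerivAt.comp x (hχ2 (ε * ((x^2 - 1)/2))).hasDerivAt (hin x))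
    have h' : HasDerivAt (deriv h₀) (1 * deriv χ (ε * ((x^2 - 1)/2))
      + x * (deriv (deriv χ) (ε * ((x^2 - 1)/2)) * (ε * x))) x := by
      rw [hD1]
      exact h
    rw [h'.deriv]
    simp
  intro ρ hρ
  rw [hD2, hD1, hh₀, hh₁]
  beta_reduce
  obtain ⟨s, hs⟩ : ∃ s, s = ε * ((ρ^2 - 1)/2) := ⟨_, rfl⟩
  rw [← hs]
  rcases le_or_gt s 1 with h1 | h1
  · rw [hd1 s h1, hd2 s h1, hlow s h1]
    have e : 1/ε * s = (ρ^2-1)/2 := by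
      rw [hs]
      field_simp
    rw [e]
    have : ρ^2 ≤ κ * ((ρ^2-1)/2 + 1) := by nlinarith [sq_nonneg ρ]
    constructor <;> nlinarith
  · have hχs : 1 ≤ χ s := by
      have := hmono h1.le
      rwa [hlow 1 le_rfl] at this
    have hk := hκ s
    have ha := hχ'0 s
    have hb := hχ''0 s
    set a := deriv χ s
    set b := deriv (deriv χ) s
    have hr : ε * ρ^2 ≤ 2*s+1 := by linarith
    have hr0 : 0 ≤ ε * ρ^2 := by positivity
    have hr3 : (ε * ρ^2)^3 ≤ (2*s+1)^3 := pow_le_pow_left₀ hr0 hr 3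
    have hA : ε * ρ^2 * a^2 ≤ (2*s+1) * a^2 := mul_le_mul_of_nonneg_right hr (sq_nonneg a)
    have hB : (ε * ρ^2)^3 * b^2 ≤ (2*s+1)^3 * b^2 := mul_le_mul_of_nonneg_right hr3 (sq_nonneg b)
    have hB0 : 0 ≤ (ε * ρ^2)^3 * b^2 := by positivity
    have hR : κ ≤ ε * (κ * (1/ε * χ s + 1)) := by
      have : ε * (κ * (1/ε * χ s + 1)) = κ * χ s + κ * ε := by field_simp
      rw [this]
      nlinarith
    constructor
    · refine le_of_mul_le_mul_left ?_ hε0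
      nlinarith
    · refine le_of_mul_le_mul_left ?_ hε0
      have hc : 0 ≤ (ε * ρ^2)^2 * (a * -b) :=
        mul_nonneg (sq_nonneg _) (mul_nonneg ha (by linarith))
      have e : ε * (ρ^2 * (a + ρ * (b * (ε * ρ)))^2)
        = ε * ρ^2 * a^2 + (ε * ρ^2)^3 * b^2 - 2 * ((ε * ρ^2)^2 * (a * -b)) := by ring
      rw [e]
      linarith
end

section
/- Let μ ≥ 0, δ₀ > 0, c' ≥ 0, and E ≥ 0 be real numbers. Let G : ℝ → ℝ be continuous and nonnegative with ∫_ℝ G(s)² ds ≤ E, and let η : ℝ → ℝ be differentiable with η'(s) ≥ −μ for all s ∈ ℝ. Assume |η(s)| ≤ c' for every s ∈ ℝ with G(s) ≤ δ₀. Then |η(s)| ≤ c' + μ E / δ₀² for all s ∈ ℝ. -/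
open MeasureTheory

/-- An interval on which `G > δ₀` has length at most `E / δ₀ ^ 2`. -/
theorem exists_small_of_long (δ₀ E : ℝ) (hδ₀ : 0 < δ₀) (hE : 0 ≤ E) (G : ℝ → ℝ)
    (hGE : ∫⁻ s : ℝ, ENNReal.ofReal ((G s)^2) ≤ ENNReal.ofReal E)
    (a b : ℝ) (hab : E / δ₀^2 < b - a) : ∃ t ∈ Set.Icc a b, G t ≤ δ₀ := by
  by_contra! hcon
  have h1 : ENNReal.ofReal (δ₀^2 * (b - a)) ≤ ENNReal.ofReal E := by
    calc ENNReal.ofReal (δ₀^2 * (b - a))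
        = ∫⁻ _ in Set.Icc a b, ENNReal.ofReal (δ₀^2) := by
          rw [setLIntegral_const, Real.volume_Icc, ENNReal.ofReal_mul (by positivity)]
      _ ≤ ∫⁻ s in Set.Icc a b, ENNReal.ofReal ((G s)^2) := by
          apply setLIntegral_mono' measurableSet_Icc
          intro x hx
          have := hcon x hx
          apply ENNReal.ofReal_le_ofReal
          gcongr
      _ ≤ ∫⁻ s : ℝ, ENNReal.ofReal ((G s)^2) := setLIntegral_le_lintegral _ _
      _ ≤ _ := hGE
  rw [ENNReal.ofReal_le_ofReal_iff hE] at h1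
  rw [div_lt_iff₀ (by positivity)] at hab
  linarith

/-- quantitative core of the uniform bound on the Lagrange
multiplier η along a Rabinowitz-Floer flow line. -/
theorem stmt_11 (μ δ₀ c' E : ℝ) (hμ : 0 ≤ μ) (hδ₀ : 0 < δ₀) (hc' : 0 ≤ c') (hE : 0 ≤ E)
    (G : ℝ → ℝ) (hGc : Continuous G) (hGnn : ∀ s : ℝ, 0 ≤ G s)
    (hGE : ∫⁻ s : ℝ, ENNReal.ofReal ((G s)^2) ≤ ENNReal.ofReal E)
    (η : ℝ → ℝ) (hη : Differentiable ℝ η) (hη' : ∀ s : ℝ, -μ ≤ deriv η s)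
    (hsmall : ∀ s : ℝ, G s ≤ δ₀ → |η s| ≤ c') :
    ∀ s : ℝ, |η s| ≤ c' + μ * E / δ₀^2 := by
  intro s
  have hmono : Monotone (fun x => η x + μ * x) := by
    have hd : ∀ x, HasDerivAt (fun x => η x + μ * x) (deriv η x + μ * 1) x := fun x =>
      (hη x).hasDerivAt.add ((hasDerivAt_id x).const_mul μ)
    apply monotone_of_deriv_nonneg (fun x => (hd x).differentiableAt)
    intro x
    rw [(hd x).deriv]
    linarith [hη' x]
  have key : ∀ L : ℝ, E / δ₀^2 < L → |η s| ≤ c' + μ * L := by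
    intro L hL
    obtain ⟨t, ht, hGt⟩ := exists_small_of_long δ₀ E hδ₀ hE G hGE (s - L) s (by linarith)
    obtain ⟨r, hr, hGr⟩ := exists_small_of_long δ₀ E hδ₀ hE G hGE s (s + L) (by linarith)
    have h1 := abs_le.1 (hsmall t hGt)
    have h2 := abs_le.1 (hsmall r hGr)
    have h3 : η t + μ * t ≤ η s + μ * s := hmono ht.2
    have h4 : η s + μ * s ≤ η r + μ * r := hmono hr.1
    have h5 : μ * (s - L) ≤ μ * t := mul_le_mul_of_nonneg_left ht.1 hμ
    have h6 : μ * r ≤ μ * (s + L) := mul_le_mul_of_nonneg_left hr.2 hμ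
    rw [abs_le]
    constructor <;> linarith
  rw [mul_div_assoc]
  have hcont : Continuous (fun L : ℝ => c' + μ * L) := by fun_prop
  refine ge_of_tendsto (hcont.continuousWithinAt (s := Set.Ioi (E / δ₀^2)) (x := E / δ₀^2)) ?_
  filter_upwards [self_mem_nhdsWithin] with L hL using key L hL
end

section
/- Let μ ≥ 0, δ₀ > 0, c' ≥ 0, E ≥ 0, and ν ≥ 0 be real numbers. Let G : [0,∞) → ℝ be continuous and nonnegative with ∫₀^∞ G(s)² ds ≤ E, and let η : [0,∞) → ℝ be differentiable with η'(s) ≥ −μ for all s ≥ 0 and η(0) ≥ −ν. Assume |η(s)| ≤ c' for every s ≥ 0 with G(s) ≤ δ₀. Then |η(s)| ≤ max(c', ν) + μ E / δ₀² for all s ≥ 0. -/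
open MeasureTheory Set

lemma length_bound (δ₀ E : ℝ) (hδ₀ : 0 < δ₀) (hE : 0 ≤ E)
    (G : ℝ → ℝ)
    (hGE : ∫⁻ s in Ici (0:ℝ), ENNReal.ofReal ((G s)^2) ≤ ENNReal.ofReal E)
    (a b : ℝ) (ha : 0 ≤ a) (h : ∀ t ∈ Ioo a b, δ₀ < G t) : b - a ≤ E / δ₀^2 := by
  have h1 : ∫⁻ s in Ioo a b, ENNReal.ofReal (δ₀^2) ≤ ENNReal.ofReal E := by
    refine le_trans ?_ hGE
    refine le_trans (setLIntegral_mono' measurableSet_Ioo (g := fun s => ENNReal.ofReal ((G s)^2)) ?_)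
      (lintegral_mono_set (fun t ht => ha.trans ht.1.le))
    intro t ht
    have := h t ht
    apply ENNReal.ofReal_le_ofReal
    gcongr
  rw [setLIntegral_const, Real.volume_Ioo, ← ENNReal.ofReal_mul (by positivity),
    ENNReal.ofReal_le_ofReal_iff hE] at h1
  rw [le_div_iff₀ (by positivity)]
  linarith

/-- half-line version of the uniform bound on the Lagrange
multiplier η along a Rabinowitz-Floer half flow line. -/
theorem stmt_12 (μ δ₀ c' E ν : ℝ) (hμ : 0 ≤ μ) (hδ₀ : 0 < δ₀) (hc' : 0 ≤ c')
    (hE : 0 ≤ E) (hν : 0 ≤ ν)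
    (G : ℝ → ℝ) (hGc : ContinuousOn G (Ici 0)) (hGnn : ∀ s ∈ Ici (0:ℝ), 0 ≤ G s)
    (hGE : ∫⁻ s in Ici (0:ℝ), ENNReal.ofReal ((G s)^2) ≤ ENNReal.ofReal E)
    (η η' : ℝ → ℝ)
    (hη : ∀ s ∈ Ici (0:ℝ), HasDerivWithinAt η (η' s) (Ici 0) s)
    (hη' : ∀ s ∈ Ici (0:ℝ), -μ ≤ η' s)
    (hη0 : -ν ≤ η 0)
    (hsmall : ∀ s ∈ Ici (0:ℝ), G s ≤ δ₀ → |η s| ≤ c') :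
    ∀ s ∈ Ici (0:ℝ), |η s| ≤ max c' ν + μ * E / δ₀^2 := by
  intro s hs
  have hs0 : (0:ℝ) ≤ s := hs
  have hlen := length_bound δ₀ E hδ₀ hE G hGE
  have hmono : MonotoneOn (fun t => η t + μ * t) (Ici 0) := by
    have hd : ∀ t ∈ Ici (0:ℝ),
        HasDerivWithinAt (fun t => η t + μ * t) (η' t + μ * 1) (Ici 0) t := fun t ht =>
      (hη t ht).add ((hasDerivWithinAt_id t _).const_mul μ)
    refine monotoneOn_of_hasDerivWithinAt_nonneg (f' := fun t => η' t + μ * 1) (convex_Ici 0)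
      (fun t ht => (hd t ht).continuousWithinAt)
      (fun t ht => (hd t (interior_subset ht)).mono interior_subset) ?_
    intro t ht
    have := hη' t (interior_subset ht)
    linarith
  have hcomp : ∀ a b : ℝ, 0 ≤ a → IsCompact (Icc a b ∩ G ⁻¹' Iic δ₀) := fun a b ha =>
    isCompact_Icc.of_isClosed_subset
      ((hGc.mono (fun t ht => ha.trans ht.1)).preimage_isClosed_of_isClosed isClosed_Icc
        isClosed_Iic) inter_subset_left
  have hm1 := le_max_left c' ν
  have hm2 := le_max_right c' ν
  have key : ∀ a b : ℝ, 0 ≤ a → a ≤ b → (∀ t ∈ Ioo a b, δ₀ < G t) →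
      η a - η b ≤ μ * E / δ₀^2 := by
    intro a b ha hab h
    have h1 := hmono (mem_Ici.2 ha) (mem_Ici.2 (ha.trans hab)) hab
    have h2 := mul_le_mul_of_nonneg_left (hlen a b ha h) hμ
    simp only at h1
    rw [mul_div_assoc]
    linarith
  rw [abs_le]
  constructor
  · by_cases hne : (Icc 0 s ∩ G ⁻¹' Iic δ₀).Nonempty
    · obtain ⟨a, ⟨⟨ha0, has⟩, haG⟩, hmax⟩ := (hcomp 0 s le_rfl).exists_isGreatest hne
      have h1 := key a s ha0 has (fun t ht => by
        by_contra hcon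
        exact absurd (hmax ⟨⟨ha0.trans ht.1.le, ht.2.le⟩, not_lt.1 hcon⟩) (not_le.2 ht.1))
      have h2 := (abs_le.1 (hsmall a ha0 haG)).1
      linarith
    · have h1 := key 0 s le_rfl hs0 (fun t ht => by
        by_contra hcon
        exact hne ⟨t, ⟨ht.1.le, ht.2.le⟩, not_lt.1 hcon⟩)
      linarith
  · have hne : (Icc s (s + E / δ₀^2 + 1) ∩ G ⁻¹' Iic δ₀).Nonempty := by
      by_contra hne
      have := hlen s (s + E / δ₀^2 + 1) hs0 (fun t ht => by
        by_contra hcon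
        exact hne ⟨t, ⟨ht.1.le, ht.2.le⟩, not_lt.1 hcon⟩)
      linarith
    obtain ⟨b, ⟨⟨hsb, hb⟩, hbG⟩, hmin⟩ := (hcomp s _ hs0).exists_isLeast hne
    have h1 := key s b hs0 hsb (fun t ht => by
        by_contra hcon
        exact absurd (hmin ⟨⟨ht.1.le, ht.2.le.trans hb⟩, not_lt.1 hcon⟩) (not_le.2 ht.2))
    have h2 := (abs_le.1 (hsmall b (hs0.trans hsb) hbG)).2
    linarith
end
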